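/- arXiv:1709.09072 — 3 statements merged into one kernel-verified Lean document; each statement's English description precedes it below -/
import Mathlib

section
/- Let c_θ ∈ (0.4, 0.5), let δ, c_θ̃ satisfy 0 < 4δ < c_θ̃ < 1, set θ = 2^(−c_θ), and let η, μ be reals with θ^(c_θ·c_θ̃/(1 − c_θ(c_θ̃ − 4δ))) < η < θ^(2/3) and 0 < μ ≤ (θη)^(1 − c_θ(c_θ̃ − 4δ)) · θ^(−4c_θ·δ). Let b be a real number and for each integer k ≥ 1 set q_k = c_θ·k + b. Then there exists a constant c₁ > 0 such that for all integers k ≥ 1: Σ_{m ∈ ℕ, m > (c_θ̃ − δ)·q_k} θ^(m − k − c_θ·δ·m) · η^m ≤ c₁ · (η³·θ^(−2))^(c_θ·δ·k) · (μ^(−1)·η)^k. -/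
theorem summable_ite_lt_pow {r : ℝ} (hr0 : 0 < r) (hr1 : r < 1) (M : ℝ) :
    Summable fun m : ℕ => if M < (m : ℝ) then r ^ m else 0 := by
  refine Summable.of_nonneg_of_le (fun m => ?_) (fun m => ?_)
    (summable_geometric_of_lt_one hr0.le hr1)
  · split_ifs <;> positivity
  · split_ifs
    · exact le_rfl
    · positivity

theorem tsum_ite_lt_pow_le {r : ℝ} (hr0 : 0 < r) (hr1 : r < 1) (M : ℝ) :
    (∑' m : ℕ, if M < (m : ℝ) then r ^ m else 0) ≤ r ^ M * (1 - r)⁻¹ := by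
  have hs := summable_ite_lt_pow hr0 hr1 M
  have hg := summable_geometric_of_lt_one hr0.le hr1
  rw [← hs.sum_add_tsum_nat_add ⌈M⌉₊, Finset.sum_eq_zero, zero_add,
    ← tsum_geometric_of_lt_one hr0.le hr1, ← tsum_mul_left]
  · refine ((summable_nat_add_iff ⌈M⌉₊).2 hs).tsum_le_tsum (fun i => ?_) (hg.mul_left _)
    split_ifs
    · rw [pow_add, mul_comm]
      gcongr
      rw [← Real.rpow_natCast]
      exact Real.rpow_le_rpow_of_exponent_ge hr0 hr1.le (Nat.le_ceil M)
    · positivity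
  · intro m hm
    exact if_neg (Nat.lt_ceil.1 (Finset.mem_range.1 hm)).le.not_gt

theorem stmt_12 (cθ cθt δ η μ b : ℝ)
    (h1 : 0.4 < cθ) (h2 : cθ < 0.5) (h3 : 0 < δ) (h4 : 4 * δ < cθt) (h5 : cθt < 1)
    (hη1 : ((2 : ℝ) ^ (-cθ)) ^ (cθ * cθt / (1 - cθ * (cθt - 4 * δ))) < η)
    (hη2 : η < ((2 : ℝ) ^ (-cθ)) ^ ((2 : ℝ) / 3))
    (hμ0 : 0 < μ)
    (hμ1 : μ ≤ (((2 : ℝ) ^ (-cθ)) * η) ^ (1 - cθ * (cθt - 4 * δ)) *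
        ((2 : ℝ) ^ (-cθ)) ^ (-(4 * cθ * δ))) :
    ∃ c₁ : ℝ, 0 < c₁ ∧ ∀ k : ℕ, 1 ≤ k →
      (∑' m : ℕ, (if (cθt - δ) * (cθ * k + b) < (m : ℝ) then
          ((2 : ℝ) ^ (-cθ)) ^ ((m : ℝ) - k - cθ * δ * m) * η ^ m else 0))
        ≤ c₁ * (η ^ (3 : ℕ) * ((2 : ℝ) ^ (-cθ)) ^ (-(2 : ℝ))) ^ (cθ * δ * k) *
            (μ⁻¹ * η) ^ k := by
  have ht0 : (0 : ℝ) < 2 ^ (-cθ) := by positivity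
  have ht1 : (2 : ℝ) ^ (-cθ) < 1 :=
    Real.rpow_lt_one_of_one_lt_of_neg one_lt_two (by linarith)
  generalize (2 : ℝ) ^ (-cθ) = t at *
  have hη0 : 0 < η := (by positivity : (0 : ℝ) < _).trans hη1
  have hη_lt : η < 1 := hη2.trans (Real.rpow_lt_one ht0.le ht1 (by norm_num))
  have hc0 : 0 < cθ := by linarith
  have hδ1 : cθ * δ < 1 := by nlinarith
  obtain ⟨r, hr⟩ : ∃ r, r = t ^ (1 - cθ * δ) * η := ⟨_, rfl⟩
  have hr0 : 0 < r := by rw [hr]; positivity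
  have hr1 : r < 1 := hr ▸
    mul_lt_one_of_nonneg_of_lt_one_left (by positivity)
      (Real.rpow_lt_one ht0.le ht1 (by linarith)) hη_lt.le
  have hL : Real.log t < 0 := Real.log_neg ht0 ht1
  have hlogr : Real.log r = (1 - cθ * δ) * Real.log t + Real.log η := by
    rw [hr, Real.log_mul (by positivity) hη0.ne', Real.log_rpow ht0]
  have hlogμ : Real.log μ ≤ (1 - cθ * (cθt - 4 * δ)) * (Real.log t + Real.log η)
      + -(4 * cθ * δ) * Real.log t := by
    have h := Real.log_le_log hμ0 hμ1
    rwa [Real.log_mul (by positivity) (by positivity), Real.log_rpow (by positivity),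
      Real.log_rpow ht0, Real.log_mul ht0.ne' hη0.ne'] at h
  have hexp : cθ * (cθt - δ) * Real.log r - Real.log t ≤
      cθ * δ * (3 * Real.log η + -2 * Real.log t) + (-Real.log μ + Real.log η) := by
    have hpos : 0 ≤ cθ * δ * (1 - cθ * (cθt - δ)) :=
      mul_nonneg (by positivity) (by nlinarith)
    have := mul_nonpos_of_nonneg_of_nonpos hpos hL.le
    rw [hlogr]
    nlinarith
  refine ⟨r ^ ((cθt - δ) * b) * (1 - r)⁻¹,
    mul_pos (by positivity) (inv_pos.2 (by linarith)), fun k _ => ?_⟩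
  have hterm (m : ℕ) : (if (cθt - δ) * (cθ * k + b) < (m : ℝ) then
      t ^ ((m : ℝ) - k - cθ * δ * m) * η ^ m else 0) =
      t ^ (-(k : ℝ)) * if (cθt - δ) * (cθ * k + b) < (m : ℝ) then r ^ m else 0 := by
    split_ifs
    · rw [hr, mul_pow, ← Real.rpow_mul_natCast ht0.le, ← mul_assoc, ← Real.rpow_add ht0]
      ring_nf
    · simp
  have hmain : t ^ (-(k : ℝ)) * r ^ ((cθt - δ) * cθ * k) ≤
      (η ^ (3 : ℕ) * t ^ (-(2 : ℝ))) ^ (cθ * δ * k) * (μ⁻¹ * η) ^ k := by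
    rw [← Real.log_le_log_iff (by positivity) (by positivity),
      Real.log_mul (by positivity) (by positivity), Real.log_mul (by positivity) (by positivity),
      Real.log_rpow ht0, Real.log_rpow hr0, Real.log_rpow (by positivity), Real.log_pow,
      Real.log_mul (by positivity) (by positivity), Real.log_mul (by positivity) hη0.ne',
      Real.log_inv, Real.log_rpow ht0, Real.log_pow]
    push_cast
    nlinarith [mul_le_mul_of_nonneg_left hexp (Nat.cast_nonneg (α := ℝ) k)]
  simp_rw [hterm]
  rw [tsum_mul_left]
  calc t ^ (-(k : ℝ)) * ∑' m : ℕ, (if (cθt - δ) * (cθ * k + b) < (m : ℝ) then r ^ m else 0)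
      ≤ t ^ (-(k : ℝ)) * (r ^ ((cθt - δ) * (cθ * k + b)) * (1 - r)⁻¹) := by
        gcongr
        exact tsum_ite_lt_pow_le hr0 hr1 _
    _ = r ^ ((cθt - δ) * b) * (1 - r)⁻¹ *
        (t ^ (-(k : ℝ)) * r ^ ((cθt - δ) * cθ * k)) := by
        rw [mul_add, Real.rpow_add hr0, ← mul_assoc (cθt - δ)]
        ring
    _ ≤ _ := by
        rw [mul_assoc _ (_ ^ (cθ * δ * k))]
        exact mul_le_mul_of_nonneg_left hmain
          (mul_nonneg (by positivity) (inv_nonneg.2 (by linarith)))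
end

section
/- Let η be real with 0 < η < 1, let k ≥ 1 be an integer, and let D, S, g be nonnegative integers. Let a₁, a₂, a₃, a₄, b₁, b₂, b₃, b₄, c_E, c_W, c_N, c_S be nonnegative integers satisfying: (i) a₂ + b₂ − a₃ − b₃ + c_E − c_W = D + S; (ii) a₁ + b₁ − a₄ − b₄ + c_N − c_S = S; (iii) a₁ + b₁ + c_N = S + g. Then 0.9·(c_E + c_W + c_N + c_S) + 0.7·(a₁ + a₂ + a₃ + a₄ + b₁ + b₂ + b₃ + b₄) + 0.2·(|a₂ − a₁| + |a₃ − a₄| + |b₂ − b₄| + |b₃ − b₁|) + 0.1·η^(k−1)·(a₁ + a₂) ≥ 0.9·D + (1.4 + 0.2·η^k)·S + 0.2·(η^(k−1) − η^k)·(S + g). -/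
theorem stmt_15 (η : ℝ) (hη0 : 0 < η) (hη1 : η < 1) (k : ℕ) (hk : 1 ≤ k)
    (D S g : ℕ)
    (a₁ a₂ a₃ a₄ b₁ b₂ b₃ b₄ cE cW cN cS : ℕ)
    (h1 : (a₂ : ℤ) + b₂ - a₃ - b₃ + cE - cW = (D : ℤ) + S)
    (h2 : (a₁ : ℤ) + b₁ - a₄ - b₄ + cN - cS = (S : ℤ))
    (h3 : (a₁ : ℤ) + b₁ + cN = (S : ℤ) + g) :
    0.9 * ((cE : ℝ) + cW + cN + cS) +
        0.7 * ((a₁ : ℝ) + a₂ + a₃ + a₄ + b₁ + b₂ + b₃ + b₄) +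
        0.2 * (|(a₂ : ℝ) - a₁| + |(a₃ : ℝ) - a₄| + |(b₂ : ℝ) - b₄| + |(b₃ : ℝ) - b₁|) +
        0.1 * η ^ (k - 1) * ((a₁ : ℝ) + a₂)
      ≥ 0.9 * (D : ℝ) + (1.4 + 0.2 * η ^ k) * (S : ℝ) +
          0.2 * (η ^ (k - 1) - η ^ k) * ((S : ℝ) + g) := by
  have e1 : (a₂ : ℝ) + b₂ - a₃ - b₃ + cE - cW = (D : ℝ) + S := by exact_mod_cast h1
  have e2 : (a₁ : ℝ) + b₁ - a₄ - b₄ + cN - cS = (S : ℝ) := by exact_mod_cast h2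
  have e3 : (a₁ : ℝ) + b₁ + cN = (S : ℝ) + g := by exact_mod_cast h3
  have hu0 : 0 ≤ η ^ (k - 1) := by positivity
  have hu1 : η ^ (k - 1) ≤ 1 := pow_le_one₀ hη0.le hη1.le
  have hvg : 0 ≤ η ^ k * (g : ℝ) := by positivity
  generalize η ^ (k - 1) = u at *
  generalize η ^ k = v at *
  have p₁ := le_abs_self ((a₂ : ℝ) - a₁)
  have q₁ := neg_abs_le ((a₂ : ℝ) - a₁)
  have q₂ := neg_abs_le ((a₃ : ℝ) - a₄)
  have p₃ := le_abs_self ((b₂ : ℝ) - b₄)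
  have q₄ := neg_abs_le ((b₃ : ℝ) - b₁)
  generalize |(a₂ : ℝ) - a₁| = m₁ at *
  generalize |(a₃ : ℝ) - a₄| = m₂ at *
  generalize |(b₂ : ℝ) - b₄| = m₃ at *
  generalize |(b₃ : ℝ) - b₁| = m₄ at *
  -- The gap is affine in `u ∈ [0, 1]`, so it suffices to bound it at both endpoints.
  have key₀ : 0 ≤ 0.9 * ((cE : ℝ) + cW + cN + cS) +
      0.7 * ((a₁ : ℝ) + a₂ + a₃ + a₄ + b₁ + b₂ + b₃ + b₄) +
      0.2 * (m₁ + m₂ + m₃ + m₄) - (0.9 * (D : ℝ) + 1.4 * S) := by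
    linarith
  have key₁ : 0 ≤ 0.9 * ((cE : ℝ) + cW + cN + cS) +
      0.7 * ((a₁ : ℝ) + a₂ + a₃ + a₄ + b₁ + b₂ + b₃ + b₄) +
      0.2 * (m₁ + m₂ + m₃ + m₄) - (0.9 * (D : ℝ) + 1.4 * S) +
      (0.1 * ((a₁ : ℝ) + a₂) - 0.2 * (S + g)) := by
    linarith
  linarith [mul_nonneg (sub_nonneg.2 hu1) key₀, mul_nonneg hu0 key₁]
end

section
/- Let η be real with 0 < η ≤ 7/8, let k ≥ 1 be an integer, and let q, s, N be reals with s ≥ 0, q ≥ 2s, and 0 ≤ N ≤ q/24. Then (2s − N)·(0.7 + 0.1·η^(k−1)) + (q − 2s + N)·0.7 ≥ 2s·(0.7 + 0.1·η^k) + 0.1·(η^(k−1) − η^k)·s. -/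
theorem stmt_16 (η : ℝ) (hη0 : 0 < η) (hη1 : η ≤ 7 / 8) (k : ℕ) (hk : 1 ≤ k)
    (q s N : ℝ) (hs : 0 ≤ s) (hq : 2 * s ≤ q) (hN0 : 0 ≤ N) (hN : N ≤ q / 24) :
    (2 * s - N) * (0.7 + 0.1 * η ^ (k - 1)) + (q - 2 * s + N) * 0.7 ≥
      2 * s * (0.7 + 0.1 * η ^ k) + 0.1 * (η ^ (k - 1) - η ^ k) * s := by
  have hpow : η ^ k = η ^ (k - 1) * η := (pow_sub_one_mul (by omega) η).symm
  have ha0 : 0 ≤ η ^ (k - 1) := by positivity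
  have ha1 : η ^ (k - 1) ≤ 1 := pow_le_one₀ hη0.le (by linarith)
  rw [hpow]
  generalize η ^ (k - 1) = a at ha0 ha1
  have h₁ : 0 ≤ a * s * (7 / 8 - η) := mul_nonneg (mul_nonneg ha0 hs) (by linarith)
  have h₂ : 0 ≤ a * (q / 24 - N) := mul_nonneg ha0 (by linarith)
  have h₃ : 0 ≤ (1 - a) * (q - 2 * s) := mul_nonneg (by linarith) (by linarith)
  have h₄ : 0 ≤ a * s := mul_nonneg ha0 hs
  linarith
end
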